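/- If G is a finite group and G/Φ(G) is nearly nilpotent, where Φ(G) is the Frattini subgroup of G, then G is nearly nilpotent. -/

import Mathlib

open Subgroup Pointwise

variable {G : Type*} [Group G]

/-- A subgroup `M` of `G` is modular if it is a modular element of the lattice of
subgroups of `G`. -/
def IsModularSubgroup (M : Subgroup G) : Prop :=
  (∀ X Z : Subgroup G, X ≤ Z → X ⊔ (M ⊓ Z) = (X ⊔ M) ⊓ Z) ∧
  (∀ Y Z : Subgroup G, M ≤ Z → M ⊔ (Y ⊓ Z) = (M ⊔ Y) ⊓ Z)

/-- A subgroup `H` of `G` is S-quasinormal if `HP = PH` for every Sylow subgroup `P` of `G`. -/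
def IsSQuasinormal (H : Subgroup G) : Prop :=
  ∀ (p : ℕ), p.Prime → ∀ P : Sylow p G,
    (H : Set G) * ((P : Subgroup G) : Set G) = ((P : Subgroup G) : Set G) * (H : Set G)

/-- `H` is a maximal subgroup of `K` (both being subgroups of the ambient group `G`). -/
def IsMaximalIn (K H : Subgroup G) : Prop :=
  H < K ∧ ∀ L : Subgroup G, H < L → L ≤ K → L = K

/-- `H` is an `n`-maximal subgroup of `G`: there is a chain
`H = M_n < … < M_1 < M_0 = G` with `M_i` maximal in `M_{i-1}` for all `i`. -/
def IsNMaximal (n : ℕ) (H : Subgroup G) : Prop :=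
  ∃ M : Fin (n + 1) → Subgroup G,
    M 0 = ⊤ ∧ M (Fin.last n) = H ∧
    ∀ i : Fin n, IsMaximalIn (M i.castSucc) (M i.succ)

/-- A group is supersoluble if it has a normal series with cyclic factors. -/
def IsSupersoluble (G : Type*) [Group G] : Prop :=
  ∃ (n : ℕ) (s : Fin (n + 1) → Subgroup G) (_hnorm : ∀ i, (s i).Normal),
    s 0 = ⊥ ∧ s (Fin.last n) = ⊤ ∧
    ∀ i : Fin n, s i.castSucc ≤ s i.succ ∧
      haveI := _hnorm i.castSucc
      IsCyclic ↥((s i.succ).map (QuotientGroup.mk' (s i.castSucc)))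

/-- `H/K` is a chief factor of `G`: both are normal in `G`, `K < H`, and there is no
normal subgroup of `G` strictly between `K` and `H` (i.e. `H/K` is a minimal normal
subgroup of `G/K`). -/
def IsChiefFactor (H K : Subgroup G) : Prop :=
  K.Normal ∧ H.Normal ∧ K < H ∧
    ∀ N : Subgroup G, N.Normal → K < N → N ≤ H → N = H

/-- The centralizer `C_G(H/K)` of a factor `H/K`: the preimage in `G` of the
centralizer of `HK/K` in `G/K`. -/
def chiefCentralizer (H K : Subgroup G) (hK : K.Normal) : Subgroup G :=
  haveI := hK
  Subgroup.comap (QuotientGroup.mk' K)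
    (Subgroup.centralizer ((H.map (QuotientGroup.mk' K) : Subgroup (G ⧸ K)) : Set (G ⧸ K)))

/-- The factor `H/K` is non-Frattini, i.e. `HK/K ≰ Φ(G/K)`. -/
def IsNonFrattini (H K : Subgroup G) (hK : K.Normal) : Prop :=
  haveI := hK
  ¬ H.map (QuotientGroup.mk' K) ≤ frattini (G ⧸ K)

/-- A group is strongly supersoluble if it is supersoluble and the automorphism group
`G/C_G(H/K)` induced by `G` on any chief factor `H/K` has square-free order. -/
def IsStronglySupersoluble (G : Type*) [Group G] : Prop :=
  IsSupersoluble G ∧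
    ∀ H K : Subgroup G, ∀ hc : IsChiefFactor H K,
      Squarefree (chiefCentralizer H K hc.1).index

/-- A group is nearly nilpotent if it is supersoluble and the automorphism group
`G/C_G(H/K)` induced by `G` on any non-Frattini chief factor `H/K` has order dividing
a prime. -/
def IsNearlyNilpotent (G : Type*) [Group G] : Prop :=
  IsSupersoluble G ∧
    ∀ H K : Subgroup G, ∀ hc : IsChiefFactor H K, IsNonFrattini H K hc.1 →
      ∃ p : ℕ, p.Prime ∧ (chiefCentralizer H K hc.1).index ∣ p

/-- The strongly supersoluble residual `G^{U_s}`: the intersection of all normal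
subgroups `N` of `G` with `G/N` strongly supersoluble. -/
def ssResidual (G : Type*) [Group G] : Subgroup G :=
  sInf {N : Subgroup G | ∃ _hN : N.Normal,
    haveI := _hN
    IsStronglySupersoluble (G ⧸ N)}

/-- A minimal normal subgroup. -/
structure IsMinimalNormal (N : Subgroup G) : Prop where
  normal : N.Normal
  ne_bot : N ≠ ⊥
  eq_of_le : ∀ M : Subgroup G, M.Normal → M ≤ N → M ≠ ⊥ → M = N

theorem exists_isMinimalNormal_le [Finite G] {N : Subgroup G} (hN : N.Normal) (hne : N ≠ ⊥) :
    ∃ M ≤ N, IsMinimalNormal M := by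
  obtain ⟨M, hMN, hM⟩ := (Set.toFinite {M : Subgroup G | M.Normal ∧ M ≠ ⊥}).exists_le_minimal
    (a := N) ⟨hN, hne⟩
  exact ⟨M, hMN, hM.prop.1, hM.prop.2, fun L hL hLM hLne =>
    le_antisymm hLM (hM.le_of_le ⟨hL, hLne⟩ hLM)⟩

theorem isCyclic_map_mk'_iff {H K : Subgroup G} [K.Normal] :
    IsCyclic (H.map (QuotientGroup.mk' K)) ↔
      ∃ x ∈ H, ∀ h ∈ H, ∃ n : ℤ, (x ^ n)⁻¹ * h ∈ K := by
  rw [Subgroup.isCyclic_iff_exists_zpowers_eq_top]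
  constructor
  · rintro ⟨y, hy⟩
    have hy' : y ∈ H.map (QuotientGroup.mk' K) := hy ▸ mem_zpowers y
    obtain ⟨x, hx, rfl⟩ := hy'
    refine ⟨x, hx, fun h hh => ?_⟩
    have hh' : QuotientGroup.mk' K h ∈ zpowers (QuotientGroup.mk' K x) :=
      hy ▸ mem_map_of_mem _ hh
    obtain ⟨n, hn⟩ := hh'
    refine ⟨n, ?_⟩
    rw [← QuotientGroup.eq]
    simpa using hn
  · rintro ⟨x, hx, h⟩
    refine ⟨QuotientGroup.mk' K x, le_antisymm ?_ ?_⟩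
    · simpa using mem_map_of_mem (QuotientGroup.mk' K) hx
    · rintro _ ⟨y, hy, rfl⟩
      obtain ⟨n, hn⟩ := h y hy
      refine ⟨n, ?_⟩
      rw [← QuotientGroup.eq] at hn
      simpa using hn

theorem IsSupersoluble.of_surjective {H : Type*} [Group H] (f : G →* H)
    (hf : Function.Surjective f) (h : IsSupersoluble G) : IsSupersoluble H := by
  obtain ⟨n, s, hs, h0, h1, hc⟩ := h
  refine ⟨n, fun i => (s i).map f, fun i => (hs i).map f hf, by simp [h0],
    by simp [h1, ← MonoidHom.range_eq_map, MonoidHom.range_eq_top.2 hf], fun i => ?_⟩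
  obtain ⟨hle, hcyc⟩ := hc i
  have := hs i.castSucc
  have := (hs i.castSucc).map f hf
  refine ⟨map_mono hle, ?_⟩
  rw [isCyclic_map_mk'_iff] at hcyc ⊢
  obtain ⟨x, hx, hx'⟩ := hcyc
  refine ⟨f x, mem_map_of_mem f hx, ?_⟩
  rintro _ ⟨y, hy, rfl⟩
  obtain ⟨n, hn⟩ := hx' y hy
  exact ⟨n, by simpa using mem_map_of_mem f hn⟩

theorem IsSupersoluble.of_isCyclic_ker {H : Type*} [Group H] (f : G →* H)
    (hf : Function.Surjective f) (hk : IsCyclic f.ker) (h : IsSupersoluble H) :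
    IsSupersoluble G := by
  obtain ⟨n, s, hs, h0, h1, hc⟩ := h
  have hn : ∀ i : Fin (n + 2), (Fin.cases ⊥ (fun i => (s i).comap f) i : Subgroup G).Normal := by
    intro i
    induction i using Fin.cases with
    | zero => exact inferInstanceAs (⊥ : Subgroup G).Normal
    | succ i => exact (hs i).comap f
  refine ⟨n + 1, Fin.cases ⊥ (fun i => (s i).comap f), hn, rfl, ?_, fun i => ?_⟩
  · change (s (Fin.last n)).comap f = ⊤
    rw [h1, comap_top]
  · rw [isCyclic_map_mk'_iff]
    induction i using Fin.cases with
    | zero =>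
      refine ⟨bot_le, ?_⟩
      obtain ⟨x, hx⟩ := (Subgroup.isCyclic_iff_exists_zpowers_eq_top _).1 hk
      change ∃ x ∈ (s 0).comap f, ∀ h ∈ (s 0).comap f, ∃ m : ℤ, (x ^ m)⁻¹ * h ∈ (⊥ : Subgroup G)
      rw [h0, MonoidHom.comap_bot]
      refine ⟨x, hx ▸ mem_zpowers x, fun y hy => ?_⟩
      rw [← hx] at hy
      obtain ⟨m, rfl⟩ := hy
      exact ⟨m, by simp⟩
    | succ i =>
      obtain ⟨hle, hcyc⟩ := hc i
      have := hs i.castSucc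
      refine ⟨?_, ?_⟩
      · rw [← Fin.succ_castSucc]
        exact comap_mono hle
      rw [isCyclic_map_mk'_iff] at hcyc
      obtain ⟨x, hx, hx'⟩ := hcyc
      obtain ⟨x, rfl⟩ := hf x
      refine ⟨x, hx, fun y hy => ?_⟩
      obtain ⟨m, hm⟩ := hx' (f y) hy
      refine ⟨m, ?_⟩
      rw [← Fin.succ_castSucc]
      simpa using hm

/-- A minimal normal subgroup on which a homomorphism to a supersoluble group is injective is
cyclic. -/
theorem IsMinimalNormal.isCyclic_of_isSupersoluble {H : Type*} [Group H] (f : G →* H)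
    (h : IsSupersoluble H) {N : Subgroup G} (hN : IsMinimalNormal N) (hf : N ⊓ f.ker = ⊥) :
    IsCyclic N := by
  obtain ⟨n, s, hs, h0, h1, hc⟩ := h
  have key : ∃ i : Fin n, N ⊓ (s i.castSucc).comap f = ⊥ ∧ N ⊓ (s i.succ).comap f ≠ ⊥ := by
    by_contra! hcon
    have hall : ∀ i : Fin (n + 1), N ⊓ (s i).comap f = ⊥ := by
      intro i
      induction i using Fin.induction with
      | zero => simpa [h0] using hf
      | succ i ih => exact hcon i ih
    have := hall (Fin.last n)
    simp only [h1, comap_top, le_top, inf_of_le_left] at this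
    exact hN.ne_bot this
  obtain ⟨i, hi, hi'⟩ := key
  obtain ⟨-, hcyc⟩ := hc i
  have hnK := hs i.castSucc
  have := (hs i.succ).comap f
  have := hN.normal
  have hle : N ≤ (s i.succ).comap f :=
    inf_eq_left.1 (hN.eq_of_le _ (normal_inf_normal _ _) inf_le_left hi')
  let φ : N →* (s i.succ).map (QuotientGroup.mk' (s i.castSucc)) :=
    ((QuotientGroup.mk' (s i.castSucc)).comp (f.comp N.subtype)).codRestrict _
      fun x => mem_map_of_mem _ (hle x.2)
  refine isCyclic_of_injective φ ((injective_iff_map_eq_one _).2 fun x hx => ?_)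
  have hx' : f x ∈ s i.castSucc := (QuotientGroup.eq_one_iff _).1 (congrArg Subtype.val hx)
  have : (x : G) ∈ N ⊓ (s i.castSucc).comap f := ⟨x.2, hx'⟩
  rw [hi] at this
  exact Subtype.ext this

/-- A commutative minimal normal subgroup of a finite group is elementary abelian. -/
theorem IsMinimalNormal.exists_pow_eq_one [Finite G] {N : Subgroup G} (hN : IsMinimalNormal N)
    (hcomm : ∀ x ∈ N, ∀ y ∈ N, x * y = y * x) :
    ∃ p : ℕ, p.Prime ∧ ∀ x ∈ N, x ^ p = 1 := by
  have hcard : Nat.card N ≠ 1 := fun h => hN.ne_bot (Subgroup.card_eq_one.1 h)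
  obtain ⟨p, hp, hpN⟩ := Nat.exists_prime_and_dvd hcard
  have := Fact.mk hp
  obtain ⟨x, hx⟩ := exists_prime_orderOf_dvd_card' p hpN
  let M : Subgroup G :=
    { carrier := {x | x ∈ N ∧ x ^ p = 1}
      one_mem' := ⟨one_mem _, one_pow _⟩
      mul_mem' := fun {a b} ha hb => ⟨mul_mem ha.1 hb.1, by
        rw [(show Commute a b from hcomm a ha.1 b hb.1).mul_pow, ha.2, hb.2, one_mul]⟩
      inv_mem' := fun {a} ha => ⟨inv_mem ha.1, by rw [inv_pow, ha.2, inv_one]⟩ }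
  have hM : M.Normal := ⟨fun x hx g => ⟨hN.normal.conj_mem x hx.1 g, by
    rw [conj_pow, hx.2, mul_one, mul_inv_cancel]⟩⟩
  have hMN : M = N := by
    refine hN.eq_of_le M hM (fun x hx => hx.1) fun hbot => ?_
    have hxM : (x : G) ∈ M := ⟨x.2, by
      have := pow_orderOf_eq_one x
      rw [hx] at this
      exact_mod_cast congrArg Subtype.val this⟩
    rw [hbot, mem_bot] at hxM
    rw [Subtype.ext (a1 := x) (a2 := 1) hxM, orderOf_one] at hx
    exact hp.one_lt.ne hx
  exact ⟨p, hp, fun x hx => (hMN ▸ hx : x ∈ M).2⟩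

theorem IsMinimalNormal.exists_card_eq_prime [Finite G] {N : Subgroup G} (hN : IsMinimalNormal N)
    (hc : IsCyclic N) : ∃ p : ℕ, p.Prime ∧ Nat.card N = p := by
  have : ∀ x ∈ N, ∀ y ∈ N, x * y = y * x := fun x hx y hy =>
    congrArg Subtype.val (hc.isMulCommutative.is_comm.comm ⟨x, hx⟩ ⟨y, hy⟩)
  obtain ⟨p, hp, h⟩ := hN.exists_pow_eq_one this
  refine ⟨p, hp, ?_⟩
  have h1 : Nat.card N ∣ p := by
    rw [← hc.exponent_eq_card]
    exact Monoid.exponent_dvd_of_forall_pow_eq_one fun x => Subtype.ext (h x x.2)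
  exact ((Nat.dvd_prime hp).1 h1).resolve_left fun h => hN.ne_bot (Subgroup.card_eq_one.1 h)

/-- If `K` and `Z` are normal subgroups such that `Z` centralizes `K` and has exponent dividing `p`,
and `K` has no element of order `p` modulo `Z`, then `K` has a normal `p`-complement. -/
theorem exists_normal_complement_of_central [Finite G] {p : ℕ} (hp : p.Prime) {K Z : Subgroup G}
    (hK : K.Normal) (hZ : Z.Normal)
    (hcen : ∀ z ∈ Z, ∀ k ∈ K, k * z = z * k) (hZp : ∀ z ∈ Z, z ^ p = 1)
    (hKZ : ∀ x ∈ K, x ^ p ∈ Z → x ∈ Z) :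
    ∃ L : Subgroup G, L.Normal ∧ (∀ x ∈ L, x ^ p = 1 → x = 1) ∧ ∀ x ∈ K, x ^ p ∈ L := by
  have := Fact.mk hp
  have hZ' : (Z.subgroupOf K) ≤ center K := fun z hz => mem_center_iff.2 fun k =>
    Subtype.ext (hcen z hz k k.2)
  obtain ⟨t, ht⟩ := index_dvd_of_le hZ'
  have hpow : ∀ x ∈ K, x ^ (Z.subgroupOf K).index ∈ Z := fun x hx =>
    (Z.subgroupOf K).pow_index_mem (⟨x, hx⟩ : K)
  have hnd : ¬ p ∣ (Z.subgroupOf K).index := by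
    intro hd
    rw [index_eq_card] at hd
    obtain ⟨x, hx⟩ := exists_prime_orderOf_dvd_card' p hd
    obtain ⟨x, rfl⟩ := QuotientGroup.mk_surjective x
    have h1 : (x ^ p : K) ∈ Z.subgroupOf K := by
      rw [← QuotientGroup.eq_one_iff, QuotientGroup.mk_pow, ← hx, pow_orderOf_eq_one]
    have h2 : x ∈ Z.subgroupOf K := hKZ x x.2 h1
    rw [(QuotientGroup.eq_one_iff x).2 h2, orderOf_one] at hx
    exact hp.one_lt.ne hx
  generalize (Z.subgroupOf K).index = m at *
  have hmul : ∀ a ∈ K, ∀ b ∈ K, (a * b) ^ m = a ^ m * b ^ m := by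
    intro a ha b hb
    have h := congrArg (· ^ t) (map_mul (MonoidHom.transferCenterPow K) ⟨a, ha⟩ ⟨b, hb⟩)
    rw [Commute.mul_pow (Subtype.ext (mem_center_iff.1 (Subtype.prop _) _))] at h
    have h' := congrArg (fun z : center K => ((z : K) : G)) h
    simpa [MonoidHom.transferCenterPow_apply, ← pow_mul, ← ht] using h'
  refine ⟨{ carrier := {x | x ∈ K ∧ x ^ m = 1}
            one_mem' := ⟨one_mem _, one_pow _⟩
            mul_mem' := fun {a b} ha hb => ⟨mul_mem ha.1 hb.1, by
              rw [hmul a ha.1 b hb.1, ha.2, hb.2, one_mul]⟩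
            inv_mem' := fun {a} ha => ⟨inv_mem ha.1, by rw [inv_pow, ha.2, inv_one]⟩ },
    ⟨fun x hx g => ⟨hK.conj_mem x hx.1 g, by rw [conj_pow, hx.2, mul_one, mul_inv_cancel]⟩⟩,
    fun x hx hxp => ?_, fun x hx => ⟨pow_mem hx p, ?_⟩⟩
  · have := pow_gcd_eq_one.2 ⟨hxp, hx.2⟩
    rwa [(Nat.Prime.coprime_iff_not_dvd hp).2 hnd, pow_one] at this
  · rw [← pow_mul, mul_comm, pow_mul]
    exact hZp _ (hpow x hx)

/-- A finite supersoluble group has a normal subgroup `A` with a normal `p`-complement such that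
the quotient by `A` is abelian of exponent dividing `p - 1`. -/
theorem IsSupersoluble.exists_normal_pNilpotent {p : ℕ} (hp : p.Prime) {G : Type*} [Group G]
    [Finite G] (h : IsSupersoluble G) :
    ∃ K A : Subgroup G, K.Normal ∧ A.Normal ∧ (∀ x ∈ K, x ^ p = 1 → x = 1) ∧
      (∀ a ∈ A, ∃ k : ℕ, a ^ p ^ k ∈ K) ∧ (∀ g h : G, g * h * g⁻¹ * h⁻¹ ∈ A) ∧
      ∀ g : G, g ^ (p - 1) ∈ A := by
  induction hn : Nat.card G using Nat.strong_induction_on generalizing G with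
  | _ n ih =>
  subst hn
  rcases eq_or_ne (⊤ : Subgroup G) ⊥ with htriv | htriv
  · exact ⟨⊥, ⊤, inferInstance, inferInstance, fun x hx _ => by simpa using hx,
      fun a _ => ⟨0, htriv ▸ mem_top _⟩, fun _ _ => mem_top _, fun _ => mem_top _⟩
  obtain ⟨Z, -, hZ⟩ := exists_isMinimalNormal_le (inferInstanceAs (⊤ : Subgroup G).Normal) htriv
  have hcyc : IsCyclic Z := hZ.isCyclic_of_isSupersoluble (MonoidHom.id G) h (by simp)
  obtain ⟨q, hq, hqZ⟩ := hZ.exists_card_eq_prime hcyc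
  have hZn := hZ.normal
  have hZq : ∀ z ∈ Z, z ^ q = 1 := fun z hz => by
    have := pow_card_eq_one' (x := (⟨z, hz⟩ : Z))
    rw [hqZ] at this
    exact congrArg Subtype.val this
  have hlt : Nat.card (G ⧸ Z) < Nat.card G := by
    rw [Z.card_eq_card_quotient_mul_card_subgroup, hqZ]
    exact lt_mul_of_one_lt_right Nat.card_pos hq.one_lt
  obtain ⟨K, A, hK, hA, hKp, hAK, hAc, hAp⟩ :=
    ih _ hlt (h.of_surjective _ (QuotientGroup.mk'_surjective Z)) rfl
  have hmem : ∀ x, x ∈ K.comap (QuotientGroup.mk' Z) → x ^ p ∈ Z → x ∈ Z := fun x hx hxp => by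
    refine (QuotientGroup.eq_one_iff x).1 (hKp _ hx ?_)
    exact (QuotientGroup.eq_one_iff (x ^ p)).2 hxp
  by_cases hqp : q = p
  · subst hqp
    have := Fact.mk hq
    let ψ : G →* MulAut Z := MulAut.conjNormal
    have hψ : ∀ g ∈ ψ.ker, ∀ z ∈ Z, g * z = z * g := by
      intro g hg z hz
      have h2 := congrArg (fun f : MulAut Z => ((f ⟨z, hz⟩ : Z) : G)) (MonoidHom.mem_ker.1 hg)
      simpa [ψ, mul_inv_eq_iff_eq_mul] using h2
    have hcommAut : ∀ a b : MulAut Z, a * b = b * a := fun a b =>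
      (IsCyclic.mulAutMulEquiv Z).injective (by rw [map_mul, map_mul, mul_comm])
    have hpowAut : ∀ a : MulAut Z, a ^ (q - 1) = 1 := fun a => by
      rw [← Nat.totient_prime hq, ← hqZ, ← IsCyclic.card_mulAut, pow_card_eq_one']
    obtain ⟨L, hL, hLp, hKL⟩ := exists_normal_complement_of_central (Z := Z)
      (K := K.comap (QuotientGroup.mk' Z) ⊓ ψ.ker) hq
      (normal_inf_normal _ _) hZn
      (fun z hz k hk => hψ k hk.2 z hz) hZq (fun x hx => hmem x hx.1)
    refine ⟨L, A.comap (QuotientGroup.mk' Z) ⊓ ψ.ker, hL, normal_inf_normal _ _, hLp,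
      fun a ha => ?_, fun g h => mem_inf.2 ⟨?_, ?_⟩, fun g => mem_inf.2 ⟨?_, ?_⟩⟩
    · obtain ⟨k, hk⟩ := hAK _ ha.1
      refine ⟨k + 1, ?_⟩
      rw [pow_succ, pow_mul]
      exact hKL _ ⟨by simpa using hk, pow_mem ha.2 _⟩
    · simpa using hAc g h
    · rw [MonoidHom.mem_ker, map_mul, map_mul, map_mul, map_inv, map_inv, hcommAut (ψ g)]
      group
    · simpa using hAp g
    · rw [MonoidHom.mem_ker, map_pow, hpowAut]
  · refine ⟨K.comap (QuotientGroup.mk' Z), A.comap (QuotientGroup.mk' Z), inferInstance,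
      inferInstance, fun x hx hxp => ?_, fun a ha => ?_, fun g h => by simpa using hAc g h,
      fun g => by simpa using hAp g⟩
    · have h1 := hZq x (hmem x hx (hxp ▸ one_mem Z))
      have := pow_gcd_eq_one.2 ⟨h1, hxp⟩
      rwa [(Nat.coprime_primes hq hp).2 hqp, pow_one] at this
    · obtain ⟨k, hk⟩ := hAK _ ha
      exact ⟨k, by simpa using hk⟩

theorem Module.End.exists_hasEigenvalue_of_pow_eq_one {p : ℕ} [Fact p.Prime] {V : Type*}
    [AddCommGroup V] [Module (ZMod p) V] [Finite V] [Nontrivial V] (T : Module.End (ZMod p) V)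
    (hT : T ^ (p - 1) = 1) : ∃ a : ZMod p, T.HasEigenvalue a := by
  have hp : p.Prime := Fact.out
  have hd : minpoly (ZMod p) T ∣ Polynomial.X ^ p - Polynomial.X := by
    apply minpoly.dvd
    have : T ^ p = T ^ (p - 1) * T := by rw [← pow_succ, Nat.sub_add_cancel hp.one_le]
    rw [map_sub, map_pow, Polynomial.aeval_X, this, hT, one_mul, sub_self]
  have hs : (minpoly (ZMod p) T).Splits := by
    refine Polynomial.Splits.of_dvd ?_ (FiniteField.X_pow_card_sub_X_ne_zero _ hp.one_lt) hd
    rw [Polynomial.splits_iff_card_roots, FiniteField.X_pow_card_sub_X_natDegree_eq _ hp.one_lt]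
    have := FiniteField.roots_X_pow_card_sub_X (ZMod p)
    rw [ZMod.card] at this
    rw [this, Finset.card_val, Finset.card_univ, ZMod.card]
  obtain ⟨a, ha⟩ := hs.exists_eval_eq_zero
    (minpoly.degree_pos (Algebra.IsIntegral.isIntegral T)).ne'
  exact ⟨a, Module.End.hasEigenvalue_of_isRoot ha⟩

theorem AddMonoidHom.exists_apply_eq_nsmul {p : ℕ} (hp : p.Prime) {V : Type*}
    [AddCommGroup V] [Finite V] [Nontrivial V] (hV : ∀ v : V, p • v = 0) (f : V →+ V)
    (hf : ∀ v, f^[p - 1] v = v) : ∃ v ≠ 0, ∃ n : ℕ, f v = n • v := by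
  have := Fact.mk hp
  have := AddCommGroup.zmodModule hV
  obtain ⟨a, ha⟩ := Module.End.exists_hasEigenvalue_of_pow_eq_one (f.toZModLinearMap p)
    (LinearMap.ext fun v => by rw [Module.End.pow_apply]; exact hf v)
  obtain ⟨v, hv⟩ := ha.exists_hasEigenvector
  refine ⟨v, hv.2, a.val, ?_⟩
  rw [← Nat.cast_smul_eq_nsmul (ZMod p), ZMod.natCast_zmod_val]
  exact hv.apply_eq_smul

/-- A minimal normal elementary abelian `p`-subgroup on which the group induces an abelian group of
exponent dividing `p - 1` is cyclic. -/
theorem IsMinimalNormal.isCyclic_of_centralizer [Finite G] {N : Subgroup G}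
    (hN : IsMinimalNormal N) {p : ℕ} (hp : p.Prime) (hcomm : ∀ x ∈ N, ∀ y ∈ N, x * y = y * x)
    (hNp : ∀ x ∈ N, x ^ p = 1)
    (hc : ∀ g h : G, ∀ x ∈ N, g * h * g⁻¹ * h⁻¹ * x = x * (g * h * g⁻¹ * h⁻¹))
    (he : ∀ g : G, ∀ x ∈ N, g ^ (p - 1) * x = x * g ^ (p - 1)) : IsCyclic N := by
  have := Fact.mk hp
  have hNn := hN.normal
  have hnt : Nontrivial N := (nontrivial_iff_ne_bot N).2 hN.ne_bot
  have eig : ∀ g : G, ∃ n : ℕ, ∃ v ∈ N, v ≠ 1 ∧ g * v * g⁻¹ = v ^ n := by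
    intro g
    let _ : CommGroup N := { (inferInstance : Group N) with
      mul_comm := fun x y => Subtype.ext (hcomm x x.2 y y.2) }
    let f : N →* N := (MulAut.conjNormal g : MulAut N).toMonoidHom
    have hf : ∀ (k : ℕ) (x : N), ((f^[k] x : N) : G) = g ^ k * x * (g ^ k)⁻¹ := by
      intro k
      induction k with
      | zero => simp
      | succ k ih =>
        intro x
        rw [Function.iterate_succ_apply', pow_succ']
        change g * (f^[k] x : N) * g⁻¹ = _
        rw [ih]
        group
    obtain ⟨v, hv, n, hn⟩ := AddMonoidHom.exists_apply_eq_nsmul hp (V := Additive N)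
      (fun x => congrArg Additive.ofMul (Subtype.ext (hNp x.toMul x.toMul.2) : x.toMul ^ p = 1))
      f.toAdditive (fun x => (Subtype.ext (by
        rw [hf, he g _ x.toMul.2, mul_inv_cancel_right]) : f^[p - 1] x.toMul = x.toMul))
    exact ⟨n, v.toMul, v.toMul.2, fun h => hv (Additive.toMul.injective (Subtype.ext h)),
      congrArg (fun x : Additive N => ((x.toMul : N) : G)) hn⟩
  have eig' : ∀ g : G, ∃ n : ℕ, ∀ x ∈ N, g * x * g⁻¹ = x ^ n := by
    intro g
    obtain ⟨n, v, hv, hv1, hgv⟩ := eig g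
    refine ⟨n, ?_⟩
    let M : Subgroup G :=
      { carrier := {x | x ∈ N ∧ g * x * g⁻¹ = x ^ n}
        one_mem' := ⟨one_mem _, by simp⟩
        mul_mem' := fun {a b} ha hb => ⟨mul_mem ha.1 hb.1, by
          rw [(show Commute a b from hcomm a ha.1 b hb.1).mul_pow, ← ha.2, ← hb.2]
          group⟩
        inv_mem' := fun {a} ha => ⟨inv_mem ha.1, by
          rw [inv_pow, ← ha.2]
          group⟩ }
    have hM : M.Normal := ⟨fun x hx h => ⟨hNn.conj_mem x hx.1 h, by
      rw [conj_pow, ← hx.2]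
      have h1 := hc g⁻¹ h⁻¹ x hx.1
      calc g * (h * x * h⁻¹) * g⁻¹
          = h * g * (g⁻¹ * h⁻¹ * g⁻¹⁻¹ * h⁻¹⁻¹ * x) * (g⁻¹ * h⁻¹ * g * h)⁻¹ * (h * g)⁻¹ := by
            group
        _ = h * (g * x * g⁻¹) * h⁻¹ := by
            rw [h1]
            group⟩⟩
    have hMN : M = N := hN.eq_of_le M hM (fun x hx => hx.1) fun hbot => by
      have : v ∈ M := ⟨hv, hgv⟩
      rw [hbot] at this
      exact hv1 this
    intro x hx
    exact (hMN ▸ hx : x ∈ M).2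
  obtain ⟨v, hv1⟩ := exists_ne (1 : N)
  have hz : zpowers (v : G) = N := by
    refine hN.eq_of_le _ ⟨?_⟩ (zpowers_le.2 v.2) ?_
    · rintro _ ⟨k, rfl⟩ g
      obtain ⟨n, hn⟩ := eig' g
      rw [← conj_zpow, hn v v.2]
      exact zpow_mem (pow_mem (mem_zpowers _) _) _
    · simpa using hv1
  exact (Subgroup.isCyclic_iff_exists_zpowers_eq_top N).2 ⟨v, hz⟩

theorem IsMinimalNormal.mul_comm_of_isNilpotent {N : Subgroup G} (hN : IsMinimalNormal N)
    [Group.IsNilpotent N] : ∀ x ∈ N, ∀ y ∈ N, x * y = y * x := by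
  have := hN.normal
  have : Nontrivial N := (nontrivial_iff_ne_bot N).2 hN.ne_bot
  have hC : (center N).map N.subtype = N :=
    hN.eq_of_le _ inferInstance (map_subtype_le _) fun h =>
      Group.IsNilpotent.center_ne_bot (G := N)
        ((map_eq_bot_iff_of_injective _ N.subtype_injective).1 h)
  intro x hx y hy
  rw [← hC] at hy
  obtain ⟨z, hz, rfl⟩ := hy
  exact congrArg Subtype.val (mem_center_iff.1 hz ⟨x, hx⟩)

/-- A normal `p`-subgroup centralizes every minimal normal `p`-subgroup that it contains. -/
theorem IsMinimalNormal.le_centralizer [Finite G] {N A : Subgroup G} (hN : IsMinimalNormal N)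
    {p : ℕ} (hp : p.Prime) (hNA : N ≤ A) (hA : A.Normal) (hAp : IsPGroup p A) :
    A ≤ centralizer N := by
  have := Fact.mk hp
  have hNn := hN.normal
  let _ : MulAction A N := MulAction.compHom N
    ((MulAut.conjNormal : G →* MulAut N).comp A.subtype)
  have hsmul : ∀ (a : A) (x : N), ((a • x : N) : G) = a * x * (a : G)⁻¹ := fun a x => rfl
  have hcard : p ∣ Nat.card N := (hAp.to_le hNA).card_eq_or_dvd.resolve_left fun h =>
    hN.ne_bot (Subgroup.card_eq_one.1 h)
  obtain ⟨b, hb, hb1⟩ := hAp.exists_fixed_point_of_prime_dvd_card_of_fixed_point N hcard (a := 1)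
    (fun a => Subtype.ext (by simp [hsmul]))
  have hbC : (b : G) ∈ centralizer A := by
    rw [mem_centralizer_iff]
    intro a ha
    have := hsmul ⟨a, ha⟩ b
    rw [hb ⟨a, ha⟩] at this
    exact (eq_mul_inv_iff_mul_eq.1 this).symm
  have hNC : N ⊓ centralizer A = N := by
    refine hN.eq_of_le _ (normal_inf_normal _ _) inf_le_left fun h => hb1 ?_
    have : (b : G) ∈ N ⊓ centralizer A := ⟨b.2, hbC⟩
    rw [h] at this
    exact Subtype.ext (mem_bot.1 this).symm
  rw [Subgroup.le_centralizer_iff]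
  exact inf_eq_left.1 hNC

/-- If `G ⧸ N` is supersoluble, where `N` is a normal subgroup of exponent dividing `p` that lies
in the Frattini subgroup and meets every nontrivial normal subgroup nontrivially, then `G ⧸ N` has
no nontrivial normal subgroup of order prime to `p`. -/
theorem IsSupersoluble.eq_bot_of_le_frattini [Finite G] {N : Subgroup G} [hNn : N.Normal]
    (h : IsSupersoluble (G ⧸ N)) (hle : N ≤ frattini G)
    (huniq : ∀ Q : Subgroup G, Q.Normal → Q ⊓ N = ⊥ → Q = ⊥) {p : ℕ} (hp : p.Prime)
    (hNp : ∀ x ∈ N, x ^ p = 1) {K : Subgroup (G ⧸ N)} (hK : K.Normal)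
    (hKp : ∀ x ∈ K, x ^ p = 1 → x = 1) : K = ⊥ := by
  by_contra hne
  obtain ⟨L, hLK, hL⟩ := exists_isMinimalNormal_le hK hne
  obtain ⟨q, hq, hLq⟩ := hL.exists_card_eq_prime
    (hL.isCyclic_of_isSupersoluble (MonoidHom.id _) h (by simp))
  have := Fact.mk hq
  have hLn := hL.normal
  have hqp : q ≠ p := by
    rintro rfl
    obtain ⟨x, hx⟩ := exists_prime_orderOf_dvd_card' (G := L) q hLq.symm.dvd
    have hx1 : (x : G ⧸ N) = 1 := hKp _ (hLK x.2) (by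
      have := pow_orderOf_eq_one x
      rw [hx] at this
      exact congrArg Subtype.val this)
    rw [Subtype.ext (a1 := x) (a2 := 1) hx1, orderOf_one] at hx
    exact hq.one_lt.ne hx
  let M := L.comap (QuotientGroup.mk' N)
  obtain ⟨Q₀⟩ : Nonempty (Sylow q M) := inferInstance
  have hfrat := Sylow.normalizer_sup_eq_top Q₀
  have hQM : (Q₀ : Subgroup M).map M.subtype ≤ M := map_subtype_le _
  have hQq : IsPGroup q ((Q₀ : Subgroup M).map M.subtype) := Q₀.isPGroup'.map _
  have hQ₀ : (Q₀ : Subgroup M) ≠ ⊥ := Q₀.ne_bot_of_dvd_card (by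
    have := card_dvd_of_surjective ((QuotientGroup.mk' N).subgroupComap L)
      ((QuotientGroup.mk' N).subgroupComap_surjective_of_surjective L
        (QuotientGroup.mk'_surjective N))
    rwa [hLq] at this)
  have hQ : (Q₀ : Subgroup M).map M.subtype ≠ ⊥ := fun h =>
    hQ₀ ((map_eq_bot_iff_of_injective _ M.subtype_injective).1 h)
  generalize (Q₀ : Subgroup M).map M.subtype = Q at *
  have hQN : Q ⊓ N = ⊥ := by
    rw [eq_bot_iff]
    rintro x ⟨hxQ, hxN⟩
    obtain ⟨k, hk⟩ := hQq ⟨x, hxQ⟩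
    have := pow_gcd_eq_one.2 ⟨congrArg Subtype.val hk, hNp x hxN⟩
    rw [(((Nat.coprime_primes hq hp).2 hqp).pow_left k), pow_one] at this
    exact this
  have hQL : Q.map (QuotientGroup.mk' N) ≤ L := map_le_iff_le_comap.2 hQM
  have hQL' : Q.map (QuotientGroup.mk' N) = L := by
    refine eq_of_le_of_card_ge hQL ?_
    rcases (Nat.dvd_prime hq).1 (hLq ▸ card_dvd_of_le hQL) with h1 | h1
    · rw [Subgroup.card_eq_one, Subgroup.map_eq_bot_iff, QuotientGroup.ker_mk'] at h1
      exact absurd (by rwa [inf_eq_left.2 h1] at hQN) hQ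
    · rw [h1, hLq]
  have hM : M = Q ⊔ N := by
    change L.comap _ = _
    rw [← hQL', comap_map_eq, QuotientGroup.ker_mk']
  rw [hM, ← sup_assoc, sup_eq_left.2 le_normalizer] at hfrat
  have hnorm := frattini_nongenerating (top_le_iff.1 (hfrat.ge.trans (sup_le_sup_left hle _)))
  exact hQ (huniq Q (normalizer_eq_top_iff.1 hnorm) hQN)

theorem IsMinimalNormal.isCyclic_of_le_frattini [Finite G] {N : Subgroup G} [hNn : N.Normal]
    (hN : IsMinimalNormal N) (hle : N ≤ frattini G) (h : IsSupersoluble (G ⧸ N))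
    (huniq : ∀ Q : Subgroup G, Q.Normal → Q ⊓ N = ⊥ → Q = ⊥) : IsCyclic N := by
  have : Group.IsNilpotent N := by
    have := frattini_nilpotent (G := G)
    exact (Group.isNilpotent_congr (subgroupOfEquivOfLe hle)).1 inferInstance
  have hcomm := hN.mul_comm_of_isNilpotent
  obtain ⟨p, hp, hNp⟩ := hN.exists_pow_eq_one hcomm
  obtain ⟨K, A, hK, hA, hKp, hAK, hAc, hAe⟩ := h.exists_normal_pNilpotent hp
  have hKbot := h.eq_bot_of_le_frattini hle huniq hp hNp hK hKp
  have hcent := hN.le_centralizer hp (A := A.comap (QuotientGroup.mk' N))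
    (fun x hx => by
      rw [mem_comap, QuotientGroup.mk'_apply, (QuotientGroup.eq_one_iff x).2 hx]
      exact one_mem A) inferInstance fun a => by
      obtain ⟨k, hk⟩ := hAK _ a.2
      rw [hKbot, ← map_pow, mem_bot, QuotientGroup.mk'_apply, QuotientGroup.eq_one_iff] at hk
      refine ⟨k + 1, Subtype.ext ?_⟩
      rw [pow_succ, pow_mul]
      exact hNp _ hk
  refine hN.isCyclic_of_centralizer hp hcomm hNp (fun g h x hx => ?_) (fun g x hx => ?_)
  · exact (mem_centralizer_iff.1 (hcent (by simpa using hAc g h)) x hx).symm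
  · exact (mem_centralizer_iff.1 (hcent (by simpa using hAe g)) x hx).symm

/-- A finite group is supersoluble if its quotient by a normal subgroup of the Frattini subgroup
is. -/
theorem IsSupersoluble.of_le_frattini {G : Type*} [Group G] [Finite G] {N : Subgroup G}
    [hN : N.Normal] (hle : N ≤ frattini G) (h : IsSupersoluble (G ⧸ N)) : IsSupersoluble G := by
  induction hn : Nat.card G using Nat.strong_induction_on generalizing G with
  | _ n ih =>
  subst hn
  rcases eq_or_ne N ⊥ with rfl | hne
  · exact h.of_surjective QuotientGroup.quotientBot.toMonoidHom
      QuotientGroup.quotientBot.surjective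
  have hstep : ∀ (M : Subgroup G) [M.Normal], M ≠ ⊥ → IsSupersoluble (G ⧸ M) := by
    intro M _ hM
    have hlt : Nat.card (G ⧸ M) < Nat.card G := by
      rw [M.card_eq_card_quotient_mul_card_subgroup]
      exact lt_mul_of_one_lt_right Nat.card_pos (M.one_lt_card_iff_ne_bot.2 hM)
    have hNM : (N.map (QuotientGroup.mk' M)).Normal :=
      hN.map _ (QuotientGroup.mk'_surjective M)
    refine ih _ hlt (N := N.map (QuotientGroup.mk' M)) ?_ ?_ rfl
    · rw [map_le_iff_le_comap]
      exact hle.trans (frattini_le_comap_frattini_of_surjective (QuotientGroup.mk'_surjective M))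
    · exact h.of_surjective (QuotientGroup.map N _ (QuotientGroup.mk' M) (le_comap_map _ _))
        (QuotientGroup.map_surjective_of_surjective _ _ _
          ((QuotientGroup.mk'_surjective _).comp (QuotientGroup.mk'_surjective M)) _)
  obtain ⟨M, hMN, hM⟩ := exists_isMinimalNormal_le hN hne
  have hMn := hM.normal
  have hcyc : IsCyclic M := by
    by_contra hnc
    refine hnc (hM.isCyclic_of_le_frattini (hMN.trans hle) (hstep M hM.ne_bot) ?_)
    intro Q hQ hQM
    by_contra hQne
    exact hnc (hM.isCyclic_of_isSupersoluble (QuotientGroup.mk' Q) (hstep Q hQne)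
      (by rwa [QuotientGroup.ker_mk', inf_comm]))
  exact (hstep M hM.ne_bot).of_isCyclic_ker (QuotientGroup.mk' M)
    (QuotientGroup.mk'_surjective M) (by rwa [QuotientGroup.ker_mk'])

theorem isCoatom_map_of_ker_le {H : Type*} [Group H] {f : G →* H} (hf : Function.Surjective f)
    {M : Subgroup G} (hM : IsCoatom M) (hk : f.ker ≤ M) : IsCoatom (M.map f) := by
  have hcM : (M.map f).comap f = M := by rw [comap_map_eq, sup_eq_left.2 hk]
  refine ⟨fun h => hM.1 ?_, fun L hL => ?_⟩
  · rw [← hcM, h, comap_top]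
  · rw [← map_comap_eq_self_of_surjective hf L, hM.2 (L.comap f), map_top_of_surjective f hf]
    rw [← hcM]
    exact (comap_lt_comap_of_surjective hf).2 hL

theorem isNonFrattini_iff {H K : Subgroup G} (hK : K.Normal) :
    IsNonFrattini H K hK ↔ ∃ M : Subgroup G, IsCoatom M ∧ K ≤ M ∧ ¬ H ≤ M := by
  unfold IsNonFrattini
  constructor
  · intro h
    simp only [frattini, Order.radical, le_iInf_iff, not_forall] at h
    obtain ⟨M, hM, hHM⟩ := h
    refine ⟨M.comap (QuotientGroup.mk' K),
      isCoatom_comap_of_surjective (QuotientGroup.mk'_surjective K) hM, ?_,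
      fun h => hHM (map_le_iff_le_comap.2 h)⟩
    conv_lhs => rw [← QuotientGroup.ker_mk' K]
    exact MonoidHom.ker_le_comap _ _
  · rintro ⟨M, hM, hKM, hHM⟩ hle
    have hcM : (M.map (QuotientGroup.mk' K)).comap (QuotientGroup.mk' K) = M := by
      rw [comap_map_eq, QuotientGroup.ker_mk', sup_eq_left.2 hKM]
    have hco : IsCoatom (M.map (QuotientGroup.mk' K)) :=
      isCoatom_map_of_ker_le (QuotientGroup.mk'_surjective K) hM
        (by rwa [QuotientGroup.ker_mk'])
    have := map_le_iff_le_comap.1 (hle.trans (frattini_le_coatom hco))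
    rw [hcM] at this
    exact hHM this

theorem mem_chiefCentralizer_iff {H K : Subgroup G} (hK : K.Normal) {g : G} :
    g ∈ chiefCentralizer H K hK ↔ ∀ h ∈ H, (h * g)⁻¹ * (g * h) ∈ K := by
  unfold chiefCentralizer
  rw [mem_comap, mem_centralizer_iff]
  constructor
  · intro hg h hh
    exact QuotientGroup.eq.1 (hg _ (mem_map_of_mem _ hh))
  · rintro hg _ ⟨h, hh, rfl⟩
    exact QuotientGroup.eq.2 (hg h hh)

/-- A non-Frattini chief factor of `G` is `G`-isomorphic to one of `G ⧸ frattini G`. -/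
theorem IsChiefFactor.map_frattini {H K : Subgroup G} (hc : IsChiefFactor H K)
    (hnf : IsNonFrattini H K hc.1) :
    ∃ hc' : IsChiefFactor (H.map (QuotientGroup.mk' (frattini G)))
        (K.map (QuotientGroup.mk' (frattini G))),
      IsNonFrattini (H.map (QuotientGroup.mk' (frattini G)))
          (K.map (QuotientGroup.mk' (frattini G))) hc'.1 ∧
        (chiefCentralizer (H.map (QuotientGroup.mk' (frattini G)))
          (K.map (QuotientGroup.mk' (frattini G))) hc'.1).index =
          (chiefCentralizer H K hc.1).index := by
  obtain ⟨M, hM, hKM, hHM⟩ := (isNonFrattini_iff hc.1).1 hnf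
  obtain ⟨hK, hH, hKH, hmin⟩ := id hc
  have hΦM : frattini G ≤ M := frattini_le_coatom hM
  have hsurj := QuotientGroup.mk'_surjective (frattini G)
  have hcomap : ∀ L : Subgroup G, (L.map (QuotientGroup.mk' (frattini G))).comap
      (QuotientGroup.mk' (frattini G)) = L ⊔ frattini G := fun L => by
    rw [comap_map_eq, QuotientGroup.ker_mk']
  have hinf : ∀ x ∈ H, x ∈ K ⊔ frattini G → x ∈ K := by
    intro x hxH hx
    by_contra hxK
    have hlt : K < H ⊓ (K ⊔ frattini G) :=
      lt_of_le_of_ne (le_inf hKH.le le_sup_left) fun h => hxK (h ▸ ⟨hxH, hx⟩)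
    have := hmin _ (normal_inf_normal _ _) hlt inf_le_left
    exact hHM ((inf_eq_left.1 this).trans (sup_le hKM hΦM))
  have hc' : IsChiefFactor (H.map (QuotientGroup.mk' (frattini G)))
      (K.map (QuotientGroup.mk' (frattini G))) := by
    refine ⟨hK.map _ hsurj, hH.map _ hsurj, lt_of_le_not_ge (map_mono hKH.le) fun h => ?_, ?_⟩
    · rw [map_le_iff_le_comap, hcomap] at h
      exact hHM (h.trans (sup_le hKM hΦM))
    · intro N hN hKN hNH
      refine le_antisymm hNH (map_le_iff_le_comap.2 ?_)
      have hlt : K < H ⊓ N.comap (QuotientGroup.mk' (frattini G)) := by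
        refine lt_of_le_of_ne (le_inf hKH.le (map_le_iff_le_comap.1 hKN.le)) fun h => ?_
        refine hKN.not_ge fun y hy => ?_
        obtain ⟨x, hx, rfl⟩ := hNH hy
        have hxK : x ∈ K := h ▸ ⟨hx, hy⟩
        exact mem_map_of_mem _ hxK
      exact inf_eq_left.1 (hmin _ (normal_inf_normal _ _) hlt inf_le_left)
  refine ⟨hc', (isNonFrattini_iff _).2 ⟨M.map (QuotientGroup.mk' (frattini G)), ?_,
    map_mono hKM, fun h => ?_⟩, ?_⟩
  · exact isCoatom_map_of_ker_le hsurj hM (by rwa [QuotientGroup.ker_mk'])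
  · rw [map_le_iff_le_comap, hcomap, sup_eq_left.2 hΦM] at h
    exact hHM h
  · rw [← index_comap_of_surjective _ hsurj]
    congr 1
    ext g
    rw [mem_comap, mem_chiefCentralizer_iff, mem_chiefCentralizer_iff]
    constructor
    · intro hg h hh
      refine hinf _ ?_ ?_
      · have := hH.conj_mem _ (inv_mem hh) g⁻¹
        simpa [mul_assoc] using mul_mem this hh
      · rw [← hcomap]
        exact hg _ (mem_map_of_mem _ hh)
    · rintro hg _ ⟨h, hh, rfl⟩
      exact mem_map_of_mem (QuotientGroup.mk' (frattini G)) (hg h hh)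

/-- If `G/Φ(G)` is nearly nilpotent, then the finite group `G` is nearly nilpotent. -/
theorem isNearlyNilpotent_of_quotient_frattini
    {G : Type*} [Group G] [Finite G] (h : IsNearlyNilpotent (G ⧸ frattini G)) :
    IsNearlyNilpotent G := by
  refine ⟨h.1.of_le_frattini le_rfl, fun H K hc hnf => ?_⟩
  obtain ⟨hc', hnf', hindex⟩ := IsChiefFactor.map_frattini hc hnf
  rw [← hindex]
  exact h.2 _ _ hc' hnf'
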